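/- arXiv:2506.14978 — 6 statements merged into one kernel-verified Lean document; each statement's English description precedes it below -/
import Mathlib

section
/- For any measurable classifiers h, y*, y*_S, y*_T : X → Y, one has ε_{μT}(h, y*_T) ≤ ε_{μS}(h, y*_S) + Δ(h, y*) + λ, where λ := ε_{μS}(y*, y*_S) + ε_{μT}(y*, y*_T). -/
open MeasureTheory

/-- Population disagreement between two classifiers under measure `μ`. -/
noncomputable def err {X Y : Type*} [MeasurableSpace X] (μ : Measure X) (h h' : X → Y) : ℝ :=
  (μ {x | h x ≠ h' x}).toReal

/-- Disagreement discrepancy between target `μT` and source `μS`. -/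
noncomputable def disc {X Y : Type*} [MeasurableSpace X] (μS μT : Measure X) (h h' : X → Y) : ℝ :=
  err μT h h' - err μS h h'

theorem err_triangle_aux {X Y : Type*} [MeasurableSpace X] (μ : Measure X) [IsProbabilityMeasure μ]
    (a b c : X → Y) : err μ a c ≤ err μ a b + err μ b c := by
  have hs : {x | a x ≠ c x} ⊆ {x | a x ≠ b x} ∪ {x | b x ≠ c x} := by
    intro x hx
    by_cases hab : a x = b x
    · right
      intro hbc
      exact hx (hab.trans hbc)
    · left
      exact hab
  exact (measureReal_mono (μ := μ) hs).trans (measureReal_union_le _ _)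

theorem err_symm_aux {X Y : Type*} [MeasurableSpace X] (μ : Measure X)
    (a b : X → Y) : err μ a b = err μ b a := by
  unfold err
  simp only [ne_comm]

/-- For any classifiers `h, y*, y*_S, y*_T`,
`ε_{μT}(h, y*_T) ≤ ε_{μS}(h, y*_S) + Δ(h, y*) + λ` where
`λ = ε_{μS}(y*, y*_S) + ε_{μT}(y*, y*_T)`. -/
theorem lemma1_error_expansion {X Y : Type*} [MeasurableSpace X] [MeasurableSpace Y]
    [MeasurableSingletonClass Y] [Fintype Y] [Nonempty Y] [DecidableEq Y]
    (μS μT : Measure X) [IsProbabilityMeasure μS] [IsProbabilityMeasure μT]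
    (h ystar yS yT : X → Y)
    (hm : Measurable h) (hmstar : Measurable ystar) (hmS : Measurable yS) (hmT : Measurable yT) :
    err μT h yT ≤ err μS h yS + disc μS μT h ystar + (err μS ystar yS + err μT ystar yT) := by
  have h1 := err_triangle_aux μT h ystar yT
  have h2 := err_triangle_aux μS h yS ystar
  have h3 := err_symm_aux μS yS ystar
  unfold disc
  linarith
end

section
/- (Concentration of the Dis² objective.) Let ĥ, h̄, y*_S : X → Y be measurable classifiers, let nS, nT ≥ 1, and let δ ∈ (0,1). With probability at least 1 − δ over i.i.d. samples xS : Fin nS → X from μS and xT : Fin nT → X from μT (joint law (Measure.pi fun _ : Fin nS => μS).prod (Measure.pi fun _ : Fin nT => μT)), it holds that ε_{μS}(ĥ, y*_S) − ε_{μS}(ĥ, h̄) + ε_{μT}(ĥ, h̄) ≤ ε̂_S(ĥ, y*_S) − ε̂_S(ĥ, h̄) + ε̂_T(ĥ, h̄) + sqrt((nS + 4·nT) · log(1/δ) / (2 · nS · nT)). -/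
open MeasureTheory

/-- Empirical disagreement between two classifiers on a finite sample. -/
noncomputable def empErr {X Y : Type*} [DecidableEq Y] {n : ℕ} (xs : Fin n → X) (h h' : X → Y) : ℝ :=
  (1 / (n : ℝ)) * ∑ i, if h (xs i) ≠ h' (xs i) then 1 else 0

open ProbabilityTheory in
lemma avg_subG {X : Type*} [MeasurableSpace X] (μ : Measure X) [IsProbabilityMeasure μ]
    (f : X → ℝ) (hf : Measurable f) (a b : ℝ) (hb : ∀ x, f x ∈ Set.Icc a b)
    (n : ℕ) (hn : 1 ≤ n) :
    ∃ c : NNReal, (c : ℝ) = ((b - a) / 2) ^ 2 / n ∧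
      HasSubgaussianMGF (fun x : Fin n → X => (1 / (n : ℝ)) * ∑ i, (f (x i) - ∫ y, f y ∂μ)) c
        (Measure.pi fun _ : Fin n => μ) := by
  have h0 := hasSubgaussianMGF_of_mem_Icc (μ := μ) hf.aemeasurable (ae_of_all _ hb)
  have h1 : ∀ i : Fin n, HasSubgaussianMGF (fun x : Fin n → X => f (x i) - ∫ y, f y ∂μ)
      ((‖b - a‖₊ / 2) ^ 2) (Measure.pi fun _ : Fin n => μ) := by
    intro i
    have hm := measurePreserving_eval (fun _ : Fin n => μ) i
    rw [← hm.map_eq] at h0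
    have := HasSubgaussianMGF.of_map hm.measurable.aemeasurable h0
    rw [hm.map_eq] at this
    exact this
  have hind : iIndepFun (fun (i : Fin n) (x : Fin n → X) => f (x i) - ∫ y, f y ∂μ)
      (Measure.pi fun _ : Fin n => μ) :=
    iIndepFun_pi (μ := fun _ : Fin n => μ) (X := fun _ x => f x - ∫ y, f y ∂μ)
      (fun i => (hf.sub_const _).aemeasurable)
  have h2 := (HasSubgaussianMGF.sum_of_iIndepFun hind (s := Finset.univ)
    (fun i _ => h1 i)).const_mul (1 / (n : ℝ))
  refine ⟨_, ?_, h2⟩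
  have : (n : ℝ) ≠ 0 := by positivity
  change (1 / (n : ℝ)) ^ 2 * ((∑ _i : Fin n, (‖b - a‖₊ / 2) ^ 2 : NNReal) : ℝ) = _
  simp only [NNReal.coe_mul, Finset.sum_const, Finset.card_univ, Fintype.card_fin,
    nsmul_eq_mul, NNReal.coe_pow, NNReal.coe_div, coe_nnnorm, NNReal.coe_natCast, Real.norm_eq_abs,
    NNReal.coe_ofNat, div_pow, sq_abs]
  field_simp

lemma integral_dis {X Y : Type*} [MeasurableSpace X] [DecidableEq Y] (μ : Measure X)
    (h h' : X → Y) (hm : MeasurableSet {x | h x ≠ h' x}) :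
    ∫ x, (if h x ≠ h' x then (1 : ℝ) else 0) ∂μ = err μ h h' := by
  have := integral_indicator_one (μ := μ) hm
  rw [err, ← Measure.real, ← this]
  refine integral_congr_ae (ae_of_all _ fun x => ?_)
  simp [Set.indicator_apply]

/-- Concentration of the Dis² objective: with probability at least `1 - δ` over i.i.d.
samples from `μS` and `μT`, the population objective is bounded by the empirical objective
plus `sqrt((nS + 4 nT) log(1/δ) / (2 nS nT))`. -/
theorem dis2_concentration {X Y : Type*} [MeasurableSpace X] [MeasurableSpace Y]
    [MeasurableSingletonClass Y] [Fintype Y] [Nonempty Y] [DecidableEq Y]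
    (μS μT : Measure X) [IsProbabilityMeasure μS] [IsProbabilityMeasure μT]
    (hhat hbar yS : X → Y)
    (mhat : Measurable hhat) (mbar : Measurable hbar) (mS : Measurable yS)
    (nS nT : ℕ) (hnS : 1 ≤ nS) (hnT : 1 ≤ nT)
    (δ : ℝ) (hδ : δ ∈ Set.Ioo (0 : ℝ) 1) :
    ENNReal.ofReal (1 - δ) ≤
      ((Measure.pi fun _ : Fin nS => μS).prod (Measure.pi fun _ : Fin nT => μT))
        {p : (Fin nS → X) × (Fin nT → X) |
          err μS hhat yS - err μS hhat hbar + err μT hhat hbar ≤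
            empErr p.1 hhat yS - empErr p.1 hhat hbar + empErr p.2 hhat hbar +
              Real.sqrt (((nS : ℝ) + 4 * (nT : ℝ)) * Real.log (1 / δ) /
                (2 * (nS : ℝ) * (nT : ℝ)))} := by
  have m1 : MeasurableSet {x | hhat x ≠ yS x} := (measurableSet_eq_fun mhat mS).compl
  have m2 : MeasurableSet {x | hhat x ≠ hbar x} := (measurableSet_eq_fun mhat mbar).compl
  set d1 : X → ℝ := fun x => if hhat x ≠ yS x then (1 : ℝ) else 0 with hd1
  set d2 : X → ℝ := fun x => if hhat x ≠ hbar x then (1 : ℝ) else 0 with hd2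
  have md1 : Measurable d1 := Measurable.ite m1 measurable_const measurable_const
  have md2 : Measurable d2 := Measurable.ite m2 measurable_const measurable_const
  have b1 : ∀ x, 0 ≤ d1 x ∧ d1 x ≤ 1 := fun x => by
    simp only [hd1]; split_ifs <;> norm_num
  have b2 : ∀ x, 0 ≤ d2 x ∧ d2 x ≤ 1 := fun x => by
    simp only [hd2]; split_ifs <;> norm_num
  have i1 : Integrable d1 μS :=
    Integrable.of_mem_Icc 0 1 md1.aemeasurable (ae_of_all _ fun x => b1 x)
  have i2 : Integrable d2 μS :=
    Integrable.of_mem_Icc 0 1 md2.aemeasurable (ae_of_all _ fun x => b2 x)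
  obtain ⟨cS, hcS, hS⟩ := avg_subG μS (fun x => d2 x - d1 x) (md2.sub md1) (-1) 1
    (fun x => ⟨by linarith [(b1 x).2, (b2 x).1], by linarith [(b1 x).1, (b2 x).2]⟩) nS hnS
  obtain ⟨cT, hcT, hT⟩ := avg_subG μT (fun x => - d2 x) md2.neg (-1) 0
    (fun x => ⟨by linarith [(b2 x).2], by linarith [(b2 x).1]⟩) nT hnT
  have eS : ∫ y, (d2 y - d1 y) ∂μS = err μS hhat hbar - err μS hhat yS := by
    rw [integral_sub i2 i1, integral_dis μS _ _ m1, integral_dis μS _ _ m2]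
  have eT : ∫ y, (- d2 y) ∂μT = - err μT hhat hbar := by
    rw [integral_neg, integral_dis μT _ _ m2]
  rw [eS] at hS
  rw [eT] at hT
  set P := (Measure.pi fun _ : Fin nS => μS) with hP
  set Q := (Measure.pi fun _ : Fin nT => μT) with hQ
  have hS' := ProbabilityTheory.HasSubgaussianMGF.of_map (μ := P.prod Q) (Y := Prod.fst)
    measurable_fst.aemeasurable (by rw [measurePreserving_fst.map_eq]; exact hS)
  have hT' := ProbabilityTheory.HasSubgaussianMGF.of_map (μ := P.prod Q) (Y := Prod.snd)
    measurable_snd.aemeasurable (by rw [measurePreserving_snd.map_eq]; exact hT)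
  have hsum := hS'.add_of_indepFun hT'
    (ProbabilityTheory.indepFun_prod₀ hS.aemeasurable hT.aemeasurable)
  have hnS' : (0 : ℝ) < nS := by exact_mod_cast hnS
  have hnT' : (0 : ℝ) < nT := by exact_mod_cast hnT
  have hL : 0 < Real.log (1 / δ) := Real.log_pos (by rw [lt_div_iff₀ hδ.1]; linarith [hδ.2])
  set ε := Real.sqrt (((nS : ℝ) + 4 * (nT : ℝ)) * Real.log (1 / δ) /
                (2 * (nS : ℝ) * (nT : ℝ))) with hε
  have hε2 : ε ^ 2 = ((nS : ℝ) + 4 * (nT : ℝ)) * Real.log (1 / δ) /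
                (2 * (nS : ℝ) * (nT : ℝ)) := Real.sq_sqrt (by positivity)
  have key := hsum.measure_ge_le (Real.sqrt_nonneg _ : 0 ≤ ε)
  have hexp : Real.exp (-ε ^ 2 / (2 * ((cS + cT : NNReal) : ℝ))) = δ := by
    have : -ε ^ 2 / (2 * ((cS + cT : NNReal) : ℝ)) = Real.log δ := by
      rw [hε2, NNReal.coe_add, hcS, hcT, one_div, Real.log_inv]
      field_simp
      ring
    rw [this, Real.exp_log hδ.1]
  rw [hexp] at key
  set G := {p : (Fin nS → X) × (Fin nT → X) |
          err μS hhat yS - err μS hhat hbar + err μT hhat hbar ≤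
            empErr p.1 hhat yS - empErr p.1 hhat hbar + empErr p.2 hhat hbar + ε} with hG
  have hcov : 1 ≤ (P.prod Q).real G + δ := by
    refine le_trans ?_ (add_le_add_right key _)
    refine le_trans ?_ (measureReal_union_le _ _)
    refine le_trans (probReal_univ (μ := P.prod Q)).ge ?_
    refine measureReal_mono ?_
    intro p _
    by_cases hp : p ∈ G
    · exact Or.inl hp
    · right
      simp only [hG, Set.mem_ofPred_eq, not_le] at hp
      have a1 : (1 / (nS : ℝ)) * ∑ i, (d2 (p.1 i) - d1 (p.1 i) -
          (err μS hhat hbar - err μS hhat yS)) =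
          empErr p.1 hhat hbar - empErr p.1 hhat yS - (err μS hhat hbar - err μS hhat yS) := by
        simp only [Finset.sum_sub_distrib, Finset.sum_const, Finset.card_univ, Fintype.card_fin,
          nsmul_eq_mul, empErr, hd1, hd2]
        field_simp
      have a2 : (1 / (nT : ℝ)) * ∑ i, (- d2 (p.2 i) - (- err μT hhat hbar)) =
          - empErr p.2 hhat hbar + err μT hhat hbar := by
        simp only [Finset.sum_sub_distrib, Finset.sum_neg_distrib, Finset.sum_const,
          Finset.card_univ, Fintype.card_fin, nsmul_eq_mul, empErr, hd2]
        field_simp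
        ring
      simp only [Set.mem_ofPred_eq, Function.comp_apply]
      rw [a1, a2]
      linarith
  rw [ENNReal.ofReal_le_iff_le_toReal (measure_ne_top _ _)]
  change 1 - δ ≤ (P.prod Q).real G
  linarith
end

section
/- (Theorem 2, split bound.) Let ĥ, h̄, y*, y*_S, y*_T : X → Y be measurable classifiers with λ := ε_{μS}(y*, y*_S) + ε_{μT}(y*, y*_T), let D ⊆ X be a measurable overlap set, and suppose Δ(ĥ, y*) ≤ Δ(ĥ, h̄). Let nS, nT ≥ 1 and δ ∈ (0,1). Then with probability at least 1 − δ over i.i.d. samples xS : Fin nS → X from μS and xT : Fin nT → X from μT (joint law (Measure.pi fun _ : Fin nS => μS).prod (Measure.pi fun _ : Fin nT => μT)), it holds that ε_{μT}(ĥ, y*_T) ≤ ε̂_S(ĥ, y*_S) + Δ̂(ĥ, h̄, D) + Δ̲̂(ĥ, h̄, D) + sqrt((nS + 4·nT) · log(1/δ) / (2 · nS · nT)) + λ. -/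
open MeasureTheory

/-- Disagreement restricted to a region `A`. -/
noncomputable def errOn {X Y : Type*} [MeasurableSpace X] (μ : Measure X) (A : Set X)
    (h h' : X → Y) : ℝ :=
  (μ {x | x ∈ A ∧ h x ≠ h' x}).toReal

open scoped Classical in
/-- Empirical disagreement restricted to a region `A`. -/
noncomputable def empErrOn {X Y : Type*} [DecidableEq Y] {n : ℕ} (xs : Fin n → X) (A : Set X)
    (h h' : X → Y) : ℝ :=
  (1 / (n : ℝ)) * ∑ i, if xs i ∈ A ∧ h (xs i) ≠ h' (xs i) then 1 else 0

/-- Empirical overlap-aware disagreement discrepancy. -/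
noncomputable def empOddDisc {X Y : Type*} [DecidableEq Y] {nS nT : ℕ}
    (xS : Fin nS → X) (xT : Fin nT → X) (D : Set X) (h h' : X → Y) : ℝ :=
  empErrOn xT Dᶜ h h' - empErrOn xS Dᶜ h h'

/-- Empirical overlap discrepancy. -/
noncomputable def empOvDisc {X Y : Type*} [DecidableEq Y] {nS nT : ℕ}
    (xS : Fin nS → X) (xT : Fin nT → X) (D : Set X) (h h' : X → Y) : ℝ :=
  empErrOn xT D h h' - empErrOn xS D h h'

open ProbabilityTheory in
lemma aux_subG {X : Type*} [MeasurableSpace X] (μ : Measure X) [IsProbabilityMeasure μ]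
    (f : X → ℝ) (mf : Measurable f) (a b : ℝ) (hf : ∀ x, f x ∈ Set.Icc a b)
    (n : ℕ) (hn : 1 ≤ n) :
    ∃ c : NNReal, (c : ℝ) = (b - a) ^ 2 / 4 / n ∧
      HasSubgaussianMGF (fun x : Fin n → X => (∫ x, f x ∂μ) - (1 / (n : ℝ)) * ∑ i, f (x i)) c
        (Measure.pi fun _ : Fin n => μ) := by
  have hn0 : (n : ℝ) ≠ 0 := by positivity
  have h1 : HasSubgaussianMGF (fun x => f x - ∫ x, f x ∂μ) ((‖b - a‖₊ / 2) ^ 2) μ :=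
    hasSubgaussianMGF_of_mem_Icc mf.aemeasurable (ae_of_all _ hf)
  have hind : iIndepFun (fun (i : Fin n) (x : Fin n → X) => f (x i) - ∫ x, f x ∂μ)
      (Measure.pi fun _ : Fin n => μ) :=
    iIndepFun_pi (X := fun (_ : Fin n) (x : X) => f x - ∫ x, f x ∂μ)
      (fun i => (mf.sub_const _).aemeasurable)
  have h2 : ∀ i ∈ (Finset.univ : Finset (Fin n)),
      HasSubgaussianMGF (fun (x : Fin n → X) => f (x i) - ∫ x, f x ∂μ)
        ((‖b - a‖₊ / 2) ^ 2) (Measure.pi fun _ : Fin n => μ) := by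
    intro i _
    have hp := measurePreserving_eval (fun _ : Fin n => μ) i
    exact HasSubgaussianMGF.of_map (Y := Function.eval i) hp.measurable.aemeasurable
      (by rw [hp.map_eq]; exact h1)
  have h3 := (HasSubgaussianMGF.sum_of_iIndepFun hind h2).const_mul (-(1 / (n : ℝ)))
  refine ⟨_, ?_, h3.congr (ae_of_all _ fun x => ?_)⟩
  · simp only [Finset.sum_const, Finset.card_univ, Fintype.card_fin, nsmul_eq_mul]
    change (-(1 / (n : ℝ))) ^ 2 * (((n : NNReal) * (‖b - a‖₊ / 2) ^ 2 : NNReal) : ℝ) = _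
    push_cast
    rw [div_pow, Real.norm_eq_abs, sq_abs]
    field_simp
    norm_num
  · simp only [Finset.sum_sub_distrib, Finset.sum_const, Finset.card_univ, Fintype.card_fin,
      nsmul_eq_mul]
    field_simp
    ring

lemma aux_split {X Y : Type*} [DecidableEq Y] {n : ℕ} (xs : Fin n → X) (D : Set X)
    (h h' : X → Y) : empErrOn xs Dᶜ h h' + empErrOn xs D h h' = empErr xs h h' := by
  classical
  unfold empErrOn empErr
  rw [← mul_add, ← Finset.sum_add_distrib]
  congr 1
  refine Finset.sum_congr rfl fun i _ => ?_
  by_cases h1 : xs i ∈ D <;> by_cases h2 : h (xs i) = h' (xs i) <;> simp [h1, h2]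

lemma aux_meas {X Y : Type*} [MeasurableSpace X] [MeasurableSpace Y]
    [MeasurableSingletonClass Y] [Fintype Y] {h h' : X → Y}
    (mh : Measurable h) (mh' : Measurable h') : MeasurableSet {x | h x ≠ h' x} :=
  (measurableSet_eq_fun mh mh').compl

lemma aux_int {X Y : Type*} [MeasurableSpace X] [MeasurableSpace Y]
    [MeasurableSingletonClass Y] [Fintype Y] [DecidableEq Y] (μ : Measure X) {h h' : X → Y}
    (mh : Measurable h) (mh' : Measurable h') :
    ∫ x, (if h x ≠ h' x then (1 : ℝ) else 0) ∂μ = err μ h h' := by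
  have := integral_indicator_one (μ := μ) (aux_meas mh mh')
  unfold err
  rw [← Measure.real, ← this]
  refine integral_congr_ae (ae_of_all _ fun x => ?_)
  simp [Set.indicator_apply]

lemma aux_mf {X Y : Type*} [MeasurableSpace X] [MeasurableSpace Y]
    [MeasurableSingletonClass Y] [Fintype Y] [DecidableEq Y] {h h' : X → Y}
    (mh : Measurable h) (mh' : Measurable h') :
    Measurable (fun x => if h x ≠ h' x then (1 : ℝ) else 0) :=
  Measurable.ite (aux_meas mh mh') measurable_const measurable_const

lemma aux_tri {X Y : Type*} [MeasurableSpace X] (μ : Measure X) [IsProbabilityMeasure μ]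
    (h1 h2 h3 : X → Y) : err μ h1 h3 ≤ err μ h1 h2 + err μ h2 h3 := by
  unfold err
  refine le_trans (measureReal_mono (μ := μ) ?_)
    (measureReal_union_le {x | h1 x ≠ h2 x} {x | h2 x ≠ h3 x})
  intro x hx
  by_contra hc
  simp only [Set.mem_union, Set.mem_setOf_eq, not_or, not_not] at hc
  exact hx (hc.1.trans hc.2)

lemma aux_symm {X Y : Type*} [MeasurableSpace X] (μ : Measure X)
    (h1 h2 : X → Y) : err μ h1 h2 = err μ h2 h1 := by
  unfold err
  simp only [ne_comm]

/-- Theorem 2 (split bound): under the critic assumption `Δ(ĥ, y*) ≤ Δ(ĥ, h̄)`, with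
probability at least `1 - δ` over i.i.d. samples,
`ε_{μT}(ĥ, y*_T) ≤ ε̂_S(ĥ, y*_S) + Δ̂(ĥ, h̄, D) + Δ̲̂(ĥ, h̄, D) + sqrt(...) + λ`. -/
theorem split_bound {X Y : Type*} [MeasurableSpace X] [MeasurableSpace Y]
    [MeasurableSingletonClass Y] [Fintype Y] [Nonempty Y] [DecidableEq Y]
    (μS μT : Measure X) [IsProbabilityMeasure μS] [IsProbabilityMeasure μT]
    (hhat hbar ystar yS yT : X → Y)
    (mhat : Measurable hhat) (mbar : Measurable hbar) (mstar : Measurable ystar)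
    (mS : Measurable yS) (mT : Measurable yT)
    (D : Set X) (mD : MeasurableSet D)
    (hcritic : disc μS μT hhat ystar ≤ disc μS μT hhat hbar)
    (nS nT : ℕ) (hnS : 1 ≤ nS) (hnT : 1 ≤ nT)
    (δ : ℝ) (hδ : δ ∈ Set.Ioo (0 : ℝ) 1) :
    ENNReal.ofReal (1 - δ) ≤
      ((Measure.pi fun _ : Fin nS => μS).prod (Measure.pi fun _ : Fin nT => μT))
        {p : (Fin nS → X) × (Fin nT → X) |
          err μT hhat yT ≤
            empErr p.1 hhat yS + empOddDisc p.1 p.2 D hhat hbar +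
              empOvDisc p.1 p.2 D hhat hbar +
              Real.sqrt (((nS : ℝ) + 4 * (nT : ℝ)) * Real.log (1 / δ) /
                (2 * (nS : ℝ) * (nT : ℝ))) +
              (err μS ystar yS + err μT ystar yT)} := by
  classical
  obtain ⟨hδ0, hδ1⟩ := hδ
  have hnS0 : (0 : ℝ) < nS := by exact_mod_cast hnS
  have hnT0 : (0 : ℝ) < nT := by exact_mod_cast hnT
  set P := (Measure.pi fun _ : Fin nS => μS).prod (Measure.pi fun _ : Fin nT => μT) with hP
  set f : X → ℝ := fun x => (if hhat x ≠ yS x then (1 : ℝ) else 0) -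
    (if hhat x ≠ hbar x then (1 : ℝ) else 0) with hf
  set g : X → ℝ := fun x => (if hhat x ≠ hbar x then (1 : ℝ) else 0) with hg
  have mf : Measurable f := (aux_mf mhat mS).sub (aux_mf mhat mbar)
  have mg : Measurable g := aux_mf mhat mbar
  obtain ⟨c1, hc1, H1⟩ := aux_subG μS f mf (-1) 1 (fun x => by
    simp only [hf]; constructor <;> split_ifs <;> norm_num) nS hnS
  obtain ⟨c2, hc2, H2⟩ := aux_subG μT g mg 0 1 (fun x => by
    simp only [hg]; constructor <;> split_ifs <;> norm_num) nT hnT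
  set F : (Fin nS → X) → ℝ :=
    fun x => (∫ x, f x ∂μS) - (1 / (nS : ℝ)) * ∑ i, f (x i) with hF
  set G : (Fin nT → X) → ℝ :=
    fun x => (∫ x, g x ∂μT) - (1 / (nT : ℝ)) * ∑ i, g (x i) with hG
  have mF : Measurable F := by fun_prop
  have mG : Measurable G := by fun_prop
  have K1 : ProbabilityTheory.HasSubgaussianMGF (F ∘ Prod.fst) c1 P :=
    ProbabilityTheory.HasSubgaussianMGF.of_map measurable_fst.aemeasurable
      (by rw [hP, measurePreserving_fst.map_eq]; exact H1)
  have K2 : ProbabilityTheory.HasSubgaussianMGF (G ∘ Prod.snd) c2 P :=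
    ProbabilityTheory.HasSubgaussianMGF.of_map measurable_snd.aemeasurable
      (by rw [hP, measurePreserving_snd.map_eq]; exact H2)
  have K := K1.add_of_indepFun K2 (ProbabilityTheory.indepFun_prod mF mG)
  set ε := Real.sqrt (((nS : ℝ) + 4 * (nT : ℝ)) * Real.log (1 / δ) /
                (2 * (nS : ℝ) * (nT : ℝ))) with hε
  have hL : 0 ≤ Real.log (1 / δ) := Real.log_nonneg (by rw [le_div_iff₀ hδ0]; linarith)
  have hε2 : ε ^ 2 = ((nS : ℝ) + 4 * (nT : ℝ)) * Real.log (1 / δ) /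
                (2 * (nS : ℝ) * (nT : ℝ)) := Real.sq_sqrt (by positivity)
  have T := K.measure_ge_le (Real.sqrt_nonneg _ : 0 ≤ ε)
  have hexp : Real.exp (-ε ^ 2 / (2 * ((c1 + c2 : NNReal) : ℝ))) = δ := by
    have : -ε ^ 2 / (2 * ((c1 + c2 : NNReal) : ℝ)) = Real.log δ := by
      rw [hε2, NNReal.coe_add, hc1, hc2, one_div, Real.log_inv]
      have : (nS : ℝ) + 4 * nT ≠ 0 := by positivity
      have : (4 * nT : ℝ) + nS ≠ 0 := by positivity
      field_simp
      ring_nf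
    rw [this, Real.exp_log hδ0]
  rw [hexp] at T
  have mB : MeasurableSet {p : (Fin nS → X) × (Fin nT → X) |
      ε ≤ (F ∘ Prod.fst) p + (G ∘ Prod.snd) p} :=
    measurableSet_le measurable_const
      ((mF.comp measurable_fst).add (mG.comp measurable_snd))
  have hcompl := probReal_compl_eq_one_sub (μ := P) mB
  have hge : 1 - δ ≤ P.real {p : (Fin nS → X) × (Fin nT → X) |
      ε ≤ (F ∘ Prod.fst) p + (G ∘ Prod.snd) p}ᶜ := by linarith
  refine (ENNReal.ofReal_le_of_le_toReal hge).trans (measure_mono ?_)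
  intro p hp
  simp only [Set.mem_compl_iff, Set.mem_setOf_eq, not_le, Function.comp] at hp ⊢
  have i1 : ∫ x, f x ∂μS = err μS hhat yS - err μS hhat hbar := by
    rw [← aux_int μS mhat mS, ← aux_int μS mhat mbar]
    refine integral_sub ?_ ?_
    · exact Integrable.of_mem_Icc 0 1 (aux_mf mhat mS).aemeasurable
        (ae_of_all _ fun x => by constructor <;> split_ifs <;> norm_num)
    · exact Integrable.of_mem_Icc 0 1 (aux_mf mhat mbar).aemeasurable
        (ae_of_all _ fun x => by constructor <;> split_ifs <;> norm_num)
  have i2 : ∫ x, g x ∂μT = err μT hhat hbar := aux_int μT mhat mbar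
  have s1 : (1 / (nS : ℝ)) * ∑ i, f (p.1 i) = empErr p.1 hhat yS - empErr p.1 hhat hbar := by
    simp only [hf, Finset.sum_sub_distrib, mul_sub, empErr]
  have s2 : (1 / (nT : ℝ)) * ∑ i, g (p.2 i) = empErr p.2 hhat hbar := rfl
  simp only [hF, hG] at hp
  rw [i1, i2, s1, s2] at hp
  have a1 := aux_split p.1 D hhat hbar
  have a2 := aux_split p.2 D hhat hbar
  have t1 := aux_tri μT hhat ystar yT
  have t2 := aux_tri μS hhat yS ystar
  have t3 := aux_symm μS yS ystar
  unfold disc at hcritic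
  unfold empOddDisc empOvDisc
  linarith
end

section
/- (Deterministic core of the ODD bound.) Let ĥ, h̄, y* : X → Y be measurable classifiers, where y* is the common true labeling function of both domains, and let D ⊆ X be a measurable overlap set. Assume the overlap assumption ε_{μT, D}(ĥ, y*) ≤ ε_{μS, D}(ĥ, y*) and the critic assumption Δ(ĥ, y*, D) ≤ Δ(ĥ, h̄, D). Then ε_{μT}(ĥ, y*) ≤ ε_{μS}(ĥ, y*) + Δ(ĥ, h̄, D). -/
open MeasureTheory

/-- Overlap-aware disagreement discrepancy (ODD), computed on the non-overlapping region. -/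
noncomputable def oddDisc {X Y : Type*} [MeasurableSpace X] (μS μT : Measure X) (D : Set X)
    (h h' : X → Y) : ℝ :=
  errOn μT Dᶜ h h' - errOn μS Dᶜ h h'

theorem err_split_aux {X Y : Type*} [MeasurableSpace X] (μ : Measure X) [IsProbabilityMeasure μ]
    (h h' : X → Y) (D : Set X) (mD : MeasurableSet D) :
    err μ h h' = errOn μ D h h' + errOn μ Dᶜ h h' := by
  unfold err errOn
  rw [← ENNReal.toReal_add (measure_ne_top _ _) (measure_ne_top _ _),
    ← measure_inter_add_diff {x | h x ≠ h' x} mD]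
  have e1 : {x | h x ≠ h' x} ∩ D = {x | x ∈ D ∧ h x ≠ h' x} := by
    ext x; simp [and_comm]
  have e2 : {x | h x ≠ h' x} \ D = {x | x ∈ Dᶜ ∧ h x ≠ h' x} := by
    ext x; simp [and_comm]
  rw [e1, e2]

/-- Deterministic core of the ODD bound: under the overlap assumption
`ε_{μT,D}(ĥ, y*) ≤ ε_{μS,D}(ĥ, y*)` and the critic assumption
`Δ(ĥ, y*, D) ≤ Δ(ĥ, h̄, D)`, we have `ε_{μT}(ĥ, y*) ≤ ε_{μS}(ĥ, y*) + Δ(ĥ, h̄, D)`. -/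
theorem odd_deterministic {X Y : Type*} [MeasurableSpace X] [MeasurableSpace Y]
    [MeasurableSingletonClass Y] [Fintype Y] [Nonempty Y] [DecidableEq Y]
    (μS μT : Measure X) [IsProbabilityMeasure μS] [IsProbabilityMeasure μT]
    (hhat hbar ystar : X → Y)
    (mhat : Measurable hhat) (mbar : Measurable hbar) (mstar : Measurable ystar)
    (D : Set X) (mD : MeasurableSet D)
    (hoverlap : errOn μT D hhat ystar ≤ errOn μS D hhat ystar)
    (hcritic : oddDisc μS μT D hhat ystar ≤ oddDisc μS μT D hhat hbar) :
    err μT hhat ystar ≤ err μS hhat ystar + oddDisc μS μT D hhat hbar := by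
  rw [err_split_aux μT hhat ystar D mD, err_split_aux μS hhat ystar D mD]
  have h2 : errOn μT Dᶜ hhat ystar - errOn μS Dᶜ hhat ystar ≤ oddDisc μS μT D hhat hbar := hcritic
  linarith
end

section
/- (Theorem 3, ODD bound.) Let ĥ, h̄, y* : X → Y be measurable classifiers, where y* is the common true labeling function of both domains, and let D ⊆ X be a measurable overlap set. Assume the overlap assumption ε_{μT, D}(ĥ, y*) ≤ ε_{μS, D}(ĥ, y*) and the critic assumption Δ(ĥ, y*, D) ≤ Δ(ĥ, h̄, D). Let nS, nT ≥ 1 and δ ∈ (0,1). Then with probability at least 1 − δ over i.i.d. samples xS : Fin nS → X from μS and xT : Fin nT → X from μT (joint law (Measure.pi fun _ : Fin nS => μS).prod (Measure.pi fun _ : Fin nT => μT)), it holds that ε_{μT}(ĥ, y*) ≤ ε̂_S(ĥ, y*) + Δ̂(ĥ, h̄, D) + sqrt((nS + 4·nT) · log(1/δ) / (2 · nS · nT)). -/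
open MeasureTheory

open ProbabilityTheory in
lemma odd_sub {X : Type*} [MeasurableSpace X] (μ : Measure X) [IsProbabilityMeasure μ]
    (f : X → ℝ) (mf : Measurable f) (a b : ℝ) (hf : ∀ x, f x ∈ Set.Icc a b)
    (n : ℕ) (hn : 1 ≤ n) :
    ∃ c : NNReal, (c : ℝ) = (b - a) ^ 2 / (4 * n) ∧
      HasSubgaussianMGF (fun p : Fin n → X => (∫ x, f x ∂μ) - (1 / (n : ℝ)) * ∑ i, f (p i)) c
        (Measure.pi fun _ : Fin n => μ) := by
  have h1 : HasSubgaussianMGF (fun x => f x - ∫ x, f x ∂μ) ((‖b - a‖₊ / 2) ^ 2) μ :=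
    hasSubgaussianMGF_of_mem_Icc mf.aemeasurable (Filter.Eventually.of_forall hf)
  have h2 : ∀ i : Fin n, HasSubgaussianMGF (fun p : Fin n → X => f (p i) - ∫ x, f x ∂μ)
      ((‖b - a‖₊ / 2) ^ 2) (Measure.pi fun _ : Fin n => μ) := by
    intro i
    have hp := measurePreserving_eval (fun _ : Fin n => μ) i
    exact HasSubgaussianMGF.of_map (Y := Function.eval i) hp.measurable.aemeasurable
      (by rw [hp.map_eq]; exact h1)
  have h3 : iIndepFun (fun (i : Fin n) (p : Fin n → X) => f (p i) - ∫ x, f x ∂μ)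
      (Measure.pi fun _ : Fin n => μ) :=
    iIndepFun_pi (X := fun _ x => f x - ∫ x, f x ∂μ)
      (fun i => (mf.sub_const _).aemeasurable)
  have h4 := (HasSubgaussianMGF.sum_of_iIndepFun h3 (s := Finset.univ)
    (fun i _ => h2 i)).const_mul (-(1 / (n : ℝ)))
  have hn0 : (n : ℝ) ≠ 0 := by positivity
  refine ⟨_, ?_, h4.congr (Filter.Eventually.of_forall fun p => ?_)⟩
  · have e : ∀ (r : ℝ) (hr : 0 ≤ r) (d : NNReal), ((NNReal.mk r hr * d : NNReal) : ℝ) = r * d :=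
      fun r hr d => rfl
    refine (e _ _ _).trans ?_
    simp
    field_simp
    norm_num
  · simp only [Finset.sum_sub_distrib, Finset.sum_const, Finset.card_univ, Fintype.card_fin,
      nsmul_eq_mul]
    field_simp
    ring

/-- Theorem 3 (ODD bound): under the overlap assumption and the ODD critic assumption, with
probability at least `1 - δ` over i.i.d. samples,
`ε_{μT}(ĥ, y*) ≤ ε̂_S(ĥ, y*) + Δ̂(ĥ, h̄, D) + sqrt((nS + 4 nT) log(1/δ) / (2 nS nT))`. -/
theorem odd_bound {X Y : Type*} [MeasurableSpace X] [MeasurableSpace Y]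
    [MeasurableSingletonClass Y] [Fintype Y] [Nonempty Y] [DecidableEq Y]
    (μS μT : Measure X) [IsProbabilityMeasure μS] [IsProbabilityMeasure μT]
    (hhat hbar ystar : X → Y)
    (mhat : Measurable hhat) (mbar : Measurable hbar) (mstar : Measurable ystar)
    (D : Set X) (mD : MeasurableSet D)
    (hoverlap : errOn μT D hhat ystar ≤ errOn μS D hhat ystar)
    (hcritic : oddDisc μS μT D hhat ystar ≤ oddDisc μS μT D hhat hbar)
    (nS nT : ℕ) (hnS : 1 ≤ nS) (hnT : 1 ≤ nT)
    (δ : ℝ) (hδ : δ ∈ Set.Ioo (0 : ℝ) 1) :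
    ENNReal.ofReal (1 - δ) ≤
      ((Measure.pi fun _ : Fin nS => μS).prod (Measure.pi fun _ : Fin nT => μT))
        {p : (Fin nS → X) × (Fin nT → X) |
          err μT hhat ystar ≤
            empErr p.1 hhat ystar + empOddDisc p.1 p.2 D hhat hbar +
              Real.sqrt (((nS : ℝ) + 4 * (nT : ℝ)) * Real.log (1 / δ) /
                (2 * (nS : ℝ) * (nT : ℝ)))} := by
  classical
  obtain ⟨hδ0, hδ1⟩ := hδ
  have mY : ∀ h h' : X → Y, Measurable h → Measurable h' →
      MeasurableSet {x | h x ≠ h' x} := fun h h' m m' =>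
    (measurableSet_eq_fun m m').compl
  set A : Set X := {x | hhat x ≠ ystar x} with hA
  set B : Set X := {x | x ∈ Dᶜ ∧ hhat x ≠ hbar x} with hB
  have mA : MeasurableSet A := mY _ _ mhat mstar
  have mB : MeasurableSet B := mD.compl.inter (mY _ _ mhat mbar)
  set g : X → ℝ := B.indicator 1 with hg
  set f : X → ℝ := fun x => A.indicator 1 x - g x with hf
  have mg : Measurable g := measurable_one.indicator mB
  have mf : Measurable f := (measurable_one.indicator mA).sub mg
  have bg : ∀ x, g x ∈ Set.Icc (0 : ℝ) 1 := by
    intro x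
    by_cases h : x ∈ B <;> simp [hg, h]
  have bf : ∀ x, f x ∈ Set.Icc (-1 : ℝ) 1 := by
    intro x
    by_cases h : x ∈ B <;> by_cases h' : x ∈ A <;> simp [hf, hg, h, h']
  obtain ⟨c1, hc1, s1⟩ := odd_sub μS f mf _ _ bf nS hnS
  obtain ⟨c2, hc2, s2⟩ := odd_sub μT g mg _ _ bg nT hnT
  have nS0 : (0 : ℝ) < nS := by positivity
  have nT0 : (0 : ℝ) < nT := by positivity
  -- expectations
  have ig : ∀ μ : Measure X, ∫ x, g x ∂μ = errOn μ Dᶜ hhat hbar := by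
    intro μ
    rw [hg, integral_indicator_one mB]; rfl
  have iA : ∀ μ : Measure X, ∫ x, A.indicator (1 : X → ℝ) x ∂μ = err μ hhat ystar := by
    intro μ
    rw [integral_indicator_one mA]; rfl
  have intf : ∫ x, f x ∂μS = err μS hhat ystar - errOn μS Dᶜ hhat hbar := by
    rw [hf, integral_sub, iA, ig]
    · exact (integrable_const (1 : ℝ)).indicator mA
    · exact (integrable_const (1 : ℝ)).indicator mB
  have split : ∀ μ : Measure X, [IsProbabilityMeasure μ] →
      err μ hhat ystar = errOn μ D hhat ystar + errOn μ Dᶜ hhat ystar := by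
    intro μ _
    have := measureReal_inter_add_sdiff (μ := μ) (s := A) mD
    rw [err, errOn, errOn]
    simp only [Measure.real] at this
    rw [← hA, ← this]
    congr 3
    · ext x; simp [hA, and_comm]
    · ext x; simp [hA, and_comm]
  have key : err μT hhat ystar ≤ (∫ x, f x ∂μS) + ∫ x, g x ∂μT := by
    rw [intf, ig, split μT]
    have := split μS
    simp only [oddDisc] at hcritic
    linarith
  have emp : ∀ p : (Fin nS → X) × (Fin nT → X),
      empErr p.1 hhat ystar + empOddDisc p.1 p.2 D hhat hbar =
        (1 / (nS : ℝ)) * ∑ i, f (p.1 i) + (1 / (nT : ℝ)) * ∑ i, g (p.2 i) := by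
    intro p
    have e1 : empErr p.1 hhat ystar = (1 / (nS : ℝ)) * ∑ i, A.indicator (1 : X → ℝ) (p.1 i) := by
      simp only [empErr, Set.indicator_apply, hA, Set.mem_ofPred_eq, Pi.one_apply]
    have e2 : ∀ (n : ℕ) (q : Fin n → X),
        empErrOn q Dᶜ hhat hbar = (1 / (n : ℝ)) * ∑ i, g (q i) := by
      intro n q
      simp only [empErrOn, hg, Set.indicator_apply, hB, Set.mem_ofPred_eq, Pi.one_apply]
      congr!
    rw [empOddDisc, e1, e2, e2]
    simp only [hf, Finset.sum_sub_distrib]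
    ring
  set PS := Measure.pi fun _ : Fin nS => μS
  set PT := Measure.pi fun _ : Fin nT => μT
  set F : (Fin nS → X) → ℝ := fun p => (∫ x, f x ∂μS) - (1 / (nS : ℝ)) * ∑ i, f (p i) with hF
  set G : (Fin nT → X) → ℝ := fun p => (∫ x, g x ∂μT) - (1 / (nT : ℝ)) * ∑ i, g (p i) with hG
  have mF : Measurable F := by fun_prop
  have mG : Measurable G := by fun_prop
  have t1 : ProbabilityTheory.HasSubgaussianMGF (fun p : (Fin nS → X) × (Fin nT → X) => F p.1) c1
      (PS.prod PT) :=
    ProbabilityTheory.HasSubgaussianMGF.of_map (Y := Prod.fst) measurable_fst.aemeasurable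
      (by rw [(measurePreserving_fst (μ := PS) (ν := PT)).map_eq]; exact s1)
  have t2 : ProbabilityTheory.HasSubgaussianMGF (fun p : (Fin nS → X) × (Fin nT → X) => G p.2) c2
      (PS.prod PT) :=
    ProbabilityTheory.HasSubgaussianMGF.of_map (Y := Prod.snd) measurable_snd.aemeasurable
      (by rw [(measurePreserving_snd (μ := PS) (ν := PT)).map_eq]; exact s2)
  have t3 := t1.add_of_indepFun t2 (ProbabilityTheory.indepFun_prod mF mG)
  set ε := Real.sqrt (((nS : ℝ) + 4 * (nT : ℝ)) * Real.log (1 / δ) /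
                (2 * (nS : ℝ) * (nT : ℝ))) with hε
  have t4 := t3.measure_ge_le (ε := ε) (Real.sqrt_nonneg _)
  have hlog : 0 ≤ Real.log (1 / δ) := Real.log_nonneg (by rw [le_div_iff₀ hδ0]; linarith)
  have hexp : Real.exp (-ε ^ 2 / (2 * ((c1 + c2 : NNReal) : ℝ))) = δ := by
    have : -ε ^ 2 / (2 * ((c1 + c2 : NNReal) : ℝ)) = Real.log δ := by
      rw [hε, Real.sq_sqrt (by positivity), NNReal.coe_add, hc1, hc2, one_div, Real.log_inv]
      have : (nS : ℝ) + 4 * nT ≠ 0 := by positivity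
      field_simp
      ring
    rw [this, Real.exp_log hδ0]
  have mZ : MeasurableSet {p : (Fin nS → X) × (Fin nT → X) | ε ≤ F p.1 + G p.2} :=
    measurableSet_le measurable_const (by fun_prop)
  have t5 : ENNReal.ofReal (1 - δ) ≤
      (PS.prod PT) {p : (Fin nS → X) × (Fin nT → X) | ε ≤ F p.1 + G p.2}ᶜ := by
    rw [← ofReal_measureReal (measure_ne_top _ _)]
    apply ENNReal.ofReal_le_ofReal
    rw [probReal_compl_eq_one_sub mZ]
    linarith
  refine t5.trans (measure_mono fun p hp => ?_)
  simp only [Set.mem_compl_iff, Set.mem_ofPred_eq, not_le] at hp ⊢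
  rw [emp p]
  simp only [hF, hG] at hp
  linarith
end

section
/- (Concentration of the ODD objective.) Let ĥ, h̄, y* : X → Y be measurable classifiers, let D ⊆ X be a measurable set, let nS, nT ≥ 1, and let δ ∈ (0,1). With probability at least 1 − δ over i.i.d. samples xS : Fin nS → X from μS and xT : Fin nT → X from μT (joint law (Measure.pi fun _ : Fin nS => μS).prod (Measure.pi fun _ : Fin nT => μT)), it holds that ε_{μS}(ĥ, y*) − ε_{μS, X∖D}(ĥ, h̄) + ε_{μT, X∖D}(ĥ, h̄) ≤ ε̂_S(ĥ, y*) − ε̂_{S, X∖D}(ĥ, h̄) + ε̂_{T, X∖D}(ĥ, h̄) + sqrt((nS + 4·nT) · log(1/δ) / (2 · nS · nT)). -/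
open MeasureTheory

open ProbabilityTheory in
lemma odd_aux {X : Type*} [MeasurableSpace X] (μ : Measure X) [IsProbabilityMeasure μ]
    (n : ℕ) (hn : 1 ≤ n) (g : X → ℝ) (hg : Measurable g) (a b : ℝ)
    (hab : ∀ x, g x ∈ Set.Icc a b) :
    ∃ c : NNReal, (c : ℝ) = ((b - a) / 2) ^ 2 / n ∧
      HasSubgaussianMGF (fun xs : Fin n → X => (∫ x, g x ∂μ) - (1 / (n : ℝ)) * ∑ i, g (xs i)) c
        (Measure.pi fun _ : Fin n => μ) := by
  have h0 : HasSubgaussianMGF (fun x => g x - ∫ x, g x ∂μ) ((‖b - a‖₊ / 2) ^ 2) μ :=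
    hasSubgaussianMGF_of_mem_Icc hg.aemeasurable (ae_of_all _ hab)
  have hind : iIndepFun (fun (i : Fin n) (xs : Fin n → X) => g (xs i) - ∫ x, g x ∂μ)
      (Measure.pi fun _ : Fin n => μ) :=
    iIndepFun_pi (X := fun _ x => g x - ∫ x, g x ∂μ) (fun _ => by fun_prop)
  have h1 : ∀ i ∈ (Finset.univ : Finset (Fin n)),
      HasSubgaussianMGF (fun xs : Fin n → X => g (xs i) - ∫ x, g x ∂μ) ((‖b - a‖₊ / 2) ^ 2)
      (Measure.pi fun _ : Fin n => μ) := by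
    intro i _
    have := HasSubgaussianMGF.of_map (μ := Measure.pi fun _ : Fin n => μ)
      (Y := fun xs : Fin n → X => xs i) (X := fun x => g x - ∫ x, g x ∂μ)
      (c := (‖b - a‖₊ / 2) ^ 2) (measurable_pi_apply i).aemeasurable
      (by
        have e := (measurePreserving_eval (fun _ : Fin n => μ) i).map_eq
        change Measure.map (fun xs : Fin n → X => xs i) _ = _ at e
        rw [e]; exact h0)
    exact this
  have h2 := (HasSubgaussianMGF.sum_of_iIndepFun hind h1).const_mul (-(1 / (n : ℝ)))
  have hn' : (n : ℝ) ≠ 0 := by positivity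
  refine ⟨_, ?_, h2.congr (ae_of_all _ fun xs => ?_)⟩
  · refine (NNReal.coe_mul _ _).trans ?_
    change (-(1 / (n : ℝ))) ^ 2 * NNReal.toReal (∑ _i : Fin n, (‖b - a‖₊ / 2) ^ 2) = _
    simp only [NNReal.coe_mul, NNReal.coe_natCast, NNReal.coe_pow, NNReal.coe_div, coe_nnnorm,
      Finset.sum_const, Finset.card_univ, Fintype.card_fin, nsmul_eq_mul]
    simp only [div_pow, Real.norm_eq_abs, sq_abs, NNReal.coe_ofNat]
    field_simp
  · simp only [Finset.sum_sub_distrib, Finset.sum_const, Finset.card_univ, Fintype.card_fin,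
      nsmul_eq_mul]
    field_simp
    ring

/-- Concentration of the ODD objective: with probability at least `1 - δ` over i.i.d.
samples from `μS` and `μT`, the population objective is bounded by the empirical objective
plus `sqrt((nS + 4 nT) log(1/δ) / (2 nS nT))`. -/
theorem odd_concentration {X Y : Type*} [MeasurableSpace X] [MeasurableSpace Y]
    [MeasurableSingletonClass Y] [Fintype Y] [Nonempty Y] [DecidableEq Y]
    (μS μT : Measure X) [IsProbabilityMeasure μS] [IsProbabilityMeasure μT]
    (hhat hbar ystar : X → Y)
    (mhat : Measurable hhat) (mbar : Measurable hbar) (mstar : Measurable ystar)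
    (D : Set X) (mD : MeasurableSet D)
    (nS nT : ℕ) (hnS : 1 ≤ nS) (hnT : 1 ≤ nT)
    (δ : ℝ) (hδ : δ ∈ Set.Ioo (0 : ℝ) 1) :
    ENNReal.ofReal (1 - δ) ≤
      ((Measure.pi fun _ : Fin nS => μS).prod (Measure.pi fun _ : Fin nT => μT))
        {p : (Fin nS → X) × (Fin nT → X) |
          err μS hhat ystar - errOn μS Dᶜ hhat hbar + errOn μT Dᶜ hhat hbar ≤
            empErr p.1 hhat ystar - empErrOn p.1 Dᶜ hhat hbar + empErrOn p.2 Dᶜ hhat hbar +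
              Real.sqrt (((nS : ℝ) + 4 * (nT : ℝ)) * Real.log (1 / δ) /
                (2 * (nS : ℝ) * (nT : ℝ)))} := by
  classical
  have hne : ∀ {h h' : X → Y}, Measurable h → Measurable h' →
      MeasurableSet {x | h x ≠ h' x} := fun m m' => (measurableSet_eq_fun m m').compl
  set A : Set X := {x | hhat x ≠ ystar x} with hA
  set B : Set X := {x | x ∈ Dᶜ ∧ hhat x ≠ hbar x} with hB
  have mA : MeasurableSet A := hne mhat mstar
  have mB : MeasurableSet B := mD.compl.inter (hne mhat mbar)
  let f : X → ℝ := fun x => A.indicator 1 x - B.indicator 1 x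
  let g : X → ℝ := fun x => B.indicator 1 x
  have mg : Measurable g := measurable_one.indicator mB
  have mf : Measurable f := (measurable_one.indicator mA).sub mg
  have hf : ∀ x, f x ∈ Set.Icc (-1 : ℝ) 1 := by
    intro x
    simp only [f, Set.indicator_apply, Pi.one_apply]
    split_ifs <;> norm_num
  have hg : ∀ x, g x ∈ Set.Icc (0 : ℝ) 1 := by
    intro x
    simp only [g, Set.indicator_apply, Pi.one_apply]
    split_ifs <;> norm_num
  have ig : ∫ x, g x ∂μT = errOn μT Dᶜ hhat hbar := by
    simp only [g, integral_indicator_one mB]; rfl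
  have if' : ∫ x, f x ∂μS = err μS hhat ystar - errOn μS Dᶜ hhat hbar := by
    simp only [f]
    rw [integral_sub, integral_indicator_one mA, integral_indicator_one mB]
    · rfl
    · exact (integrable_const (1 : ℝ)).indicator mA
    · exact (integrable_const (1 : ℝ)).indicator mB
  have eg : ∀ xs : Fin nT → X, (1 / (nT : ℝ)) * ∑ i, g (xs i) = empErrOn xs Dᶜ hhat hbar := by
    intro xs
    simp only [g, empErrOn, Set.indicator_apply, Pi.one_apply, hB, Set.mem_ofPred_eq]
    congr!
  have ef : ∀ xs : Fin nS → X, (1 / (nS : ℝ)) * ∑ i, f (xs i) =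
      empErr xs hhat ystar - empErrOn xs Dᶜ hhat hbar := by
    intro xs
    rw [empErr, empErrOn, ← mul_sub, ← Finset.sum_sub_distrib]
    simp only [f, Set.indicator_apply, Pi.one_apply, hA, hB, Set.mem_ofPred_eq]
    congr!
  obtain ⟨cS, hcS, sS⟩ := odd_aux μS nS hnS f mf _ _ hf
  obtain ⟨cT, hcT, sT⟩ := odd_aux μT nT hnT g mg _ _ hg
  rw [if'] at sS
  rw [ig] at sT
  simp only [ef] at sS
  simp only [eg] at sT
  set P := (Measure.pi fun _ : Fin nS => μS).prod (Measure.pi fun _ : Fin nT => μT) with hP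
  have sS' := ProbabilityTheory.HasSubgaussianMGF.of_map (μ := P) (Y := Prod.fst)
    (by fun_prop) (by rw [hP, measurePreserving_fst.map_eq]; exact sS)
  have sT' := ProbabilityTheory.HasSubgaussianMGF.of_map (μ := P) (Y := Prod.snd)
    (by fun_prop) (by rw [hP, measurePreserving_snd.map_eq]; exact sT)
  have key := sS'.add_of_indepFun sT'
    (ProbabilityTheory.indepFun_prod₀ sS.aemeasurable sT.aemeasurable)
  have hS0 : (0 : ℝ) < nS := by exact_mod_cast hnS
  have hT0 : (0 : ℝ) < nT := by exact_mod_cast hnT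
  have hL : 0 < Real.log (1 / δ) := Real.log_pos (by rw [lt_div_iff₀ hδ.1]; linarith [hδ.2])
  have tail := key.measure_ge_le (Real.sqrt_nonneg (((nS : ℝ) + 4 * (nT : ℝ)) *
    Real.log (1 / δ) / (2 * (nS : ℝ) * (nT : ℝ))))
  rw [Real.sq_sqrt (by positivity)] at tail
  have ee : -(((nS : ℝ) + 4 * (nT : ℝ)) * Real.log (1 / δ) / (2 * (nS : ℝ) * (nT : ℝ))) /
      (2 * ((cS + cT : NNReal) : ℝ)) = Real.log δ := by
    rw [NNReal.coe_add, hcS, hcT, one_div, Real.log_inv]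
    field_simp
    ring
  rw [ee, Real.exp_log hδ.1] at tail
  set G : Set ((Fin nS → X) × (Fin nT → X)) := {p |
          err μS hhat ystar - errOn μS Dᶜ hhat hbar + errOn μT Dᶜ hhat hbar ≤
            empErr p.1 hhat ystar - empErrOn p.1 Dᶜ hhat hbar + empErrOn p.2 Dᶜ hhat hbar +
              Real.sqrt (((nS : ℝ) + 4 * (nT : ℝ)) * Real.log (1 / δ) /
                (2 * (nS : ℝ) * (nT : ℝ)))} with hG
  have hb : P.real Gᶜ ≤ δ := by
    refine le_trans (measureReal_mono ?_) tail
    intro p hp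
    simp only [hG, Set.mem_compl_iff, Set.mem_ofPred_eq, not_le] at hp
    simp only [Set.mem_ofPred_eq, Function.comp]
    linarith
  have hu : (1 : ℝ) ≤ P.real G + P.real Gᶜ := by
    have := measureReal_union_le (μ := P) G Gᶜ
    rwa [Set.union_compl_self, probReal_univ] at this
  rw [← ofReal_measureReal (μ := P) (s := G)]
  exact ENNReal.ofReal_le_ofReal (by linarith)
end
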